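/- arXiv:1605.04691 — 2 statements merged into one kernel-verified Lean document; each statement's English description precedes it below -/
import Mathlib

section
/- Let T = (S, B, A, F, tr, ff, avs) be a task, let π be a strategy for some start state s0 ∈ B, and let P ⊆ F × A contain the graph of π, i.e., (f, a) ∈ P whenever a ∈ π(f). Suppose an A-learning removal step is triggered at a state s ∈ S and action a ∈ prop_s(P), meaning that (s, a) ∈ avs or some s' ∈ tr(s, a) satisfies prop_{s'}(P) = ∅. Then the resulting set P \ (ff(s) × {a}) still contains the graph of π; equivalently, a ∉ prop_s(π). -/
/-- The set of actions proposed by policy `π` for state `s`,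
given the feature function `ff`. -/
def propActs {S A F : Type*} (ff : S → Set F) (π : F → Set A) (s : S) : Set A :=
  ⋃ f ∈ ff s, π f

/-- The set of actions proposed for state `s` by the policy determined by a
set `P` of feature-action pairs. -/
def propP {S A F : Type*} (ff : S → Set F) (P : Set (F × A)) (s : S) : Set A :=
  ⋃ f ∈ ff s, {a | (f, a) ∈ P}

/-- A policy `π` is a strategy for a start state `s0`. -/
def IsStrategy {S A F : Type*} (tr : S → A → Set S) (ff : S → Set F)
    (avs : Set (S × A)) (π : F → Set A) (s0 : S) : Prop :=
  propActs ff π s0 ≠ ∅ ∧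
  ∀ s : S, ∀ a ∈ propActs ff π s,
    (∀ s' ∈ tr s a, propActs ff π s' ≠ ∅) ∧ (s, a) ∉ avs

/-- an A-learning removal step triggered at `(s, a)` never removes
a feature-action pair of a strategy `π` whose graph is contained in `P`;
equivalently, the offending action `a` is not proposed by `π` at `s`. -/
theorem removal_step_preserves_strategy
    {S A F : Type*} [Nonempty S] [Nonempty A] [Finite A] [Nonempty F] [Finite F]
    (B : Set S) (hBfin : B.Finite) (hBne : B.Nonempty)
    (tr : S → A → Set S) (ff : S → Set F) (avs : Set (S × A))
    (π : F → Set A) (s0 : S) (hs0 : s0 ∈ B)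
    (hstrat : IsStrategy tr ff avs π s0)
    (P : Set (F × A)) (hP : ∀ f a, a ∈ π f → (f, a) ∈ P)
    (s : S) (a : A) (haP : a ∈ propP ff P s)
    (htrig : (s, a) ∈ avs ∨ ∃ s' ∈ tr s a, propP ff P s' = ∅) :
    (∀ f b, b ∈ π f → (f, b) ∈ P \ (ff s ×ˢ ({a} : Set A))) ∧
      a ∉ propActs ff π s := by
  have ha : a ∉ propActs ff π s := by
    intro ha
    obtain ⟨hsucc, hav⟩ := hstrat.2 s a ha
    rcases htrig with h | ⟨s', hs', hempty⟩
    · exact hav h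
    · have hsub : propActs ff π s' ⊆ propP ff P s' :=
        Set.iUnion₂_mono fun f _ b hb => hP f b hb
      exact hsucc s' hs' (Set.subset_eq_empty hsub hempty)
  refine ⟨fun f b hb => ⟨hP f b hb, ?_⟩, ha⟩
  rintro ⟨hf, rfl⟩
  exact ha (Set.mem_biUnion hf hb)
end

section
/- Let T = (S, B, A, F, tr, ff, avs) be a task, s0 ∈ B, and P ⊆ F × A a set of feature-action pairs with prop_{s0}(P) ≠ ∅. Call a finite sequence s0, a0, s1, a1, …, s_n a P-path from s0 if a_i ∈ prop_{s_i}(P) and s_{i+1} ∈ tr(s_i, a_i) for all i < n. Suppose P is a fixpoint in the following sense: for every P-path s0, a0, …, s_n from s0 and every action a ∈ prop_{s_n}(P) such that (s_n, a) ∈ avs or some s' ∈ tr(s_n, a) satisfies prop_{s'}(P) = ∅, it holds that P \ (ff(s_n) × {a}) = P. Then every P-path s0, a0, …, s_n from s0 satisfies: (s_i, a_i) ∉ avs for all i < n, and prop_{s_i}(P) ≠ ∅ for all i ≤ n. -/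
/-- A `P`-path from `s0`: the sequence `σ 0, α 0, σ 1, α 1, …, σ n` starts at
`s0`, every taken action is proposed by `P`, and each next state is a possible
successor. -/
def IsPPath {S A F : Type*} (tr : S → A → Set S) (ff : S → Set F)
    (P : Set (F × A)) (s0 : S) (σ : ℕ → S) (α : ℕ → A) (n : ℕ) : Prop :=
  σ 0 = s0 ∧ ∀ i < n, α i ∈ propP ff P (σ i) ∧ σ (i + 1) ∈ tr (σ i) (α i)

/-- An initial segment of a `P`-path is a `P`-path. -/
theorem IsPPath.mono {S A F : Type*} {tr : S → A → Set S} {ff : S → Set F}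
    {P : Set (F × A)} {s0 : S} {σ : ℕ → S} {α : ℕ → A} {m n : ℕ}
    (h : IsPPath tr ff P s0 σ α n) (hmn : m ≤ n) : IsPPath tr ff P s0 σ α m :=
  ⟨h.1, fun i hi => h.2 i (hi.trans_le hmn)⟩

/-- Removing a proposed action at a state always changes `P`. -/
theorem diff_prod_singleton_ne_of_mem_propP {S A F : Type*} {ff : S → Set F}
    {P : Set (F × A)} {s : S} {a : A} (ha : a ∈ propP ff P s) :
    P \ (ff s ×ˢ ({a} : Set A)) ≠ P := by
  intro h
  simp only [propP, Set.mem_iUnion, Set.mem_ofPred_eq, exists_prop] at ha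
  obtain ⟨f, hf, hfa⟩ := ha
  rw [← h] at hfa
  exact hfa.2 ⟨hf, rfl⟩

/-- if `P` is a fixpoint (no A-learning removal step reachable
along a `P`-path from `s0` changes `P`), then every `P`-path from `s0` avoids
aversive signals and blocked states. -/
theorem fixpoint_paths_safe
    {S A F : Type*} [Nonempty S] [Nonempty A] [Finite A] [Nonempty F] [Finite F]
    (B : Set S) (hBfin : B.Finite) (hBne : B.Nonempty)
    (tr : S → A → Set S) (ff : S → Set F) (avs : Set (S × A))
    (P : Set (F × A)) (s0 : S) (hs0 : s0 ∈ B)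
    (hs0prop : propP ff P s0 ≠ ∅)
    (hfix : ∀ (σ : ℕ → S) (α : ℕ → A) (n : ℕ), IsPPath tr ff P s0 σ α n →
      ∀ a ∈ propP ff P (σ n),
        ((σ n, a) ∈ avs ∨ ∃ s' ∈ tr (σ n) a, propP ff P s' = ∅) →
          P \ (ff (σ n) ×ˢ ({a} : Set A)) = P) :
    ∀ (σ : ℕ → S) (α : ℕ → A) (n : ℕ), IsPPath tr ff P s0 σ α n →
      (∀ i < n, (σ i, α i) ∉ avs) ∧ (∀ i ≤ n, propP ff P (σ i) ≠ ∅) := by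
  intro σ α n hpath
  have hsafe : ∀ i < n, ¬((σ i, α i) ∈ avs ∨ ∃ s' ∈ tr (σ i) (α i), propP ff P s' = ∅) :=
    fun i hi h => diff_prod_singleton_ne_of_mem_propP (hpath.2 i hi).1
      (hfix σ α i (hpath.mono hi.le) (α i) (hpath.2 i hi).1 h)
  refine ⟨fun i hi h => hsafe i hi (Or.inl h), fun i hi => ?_⟩
  cases i with
  | zero => rwa [hpath.1]
  | succ k => exact fun h => hsafe k hi (Or.inr ⟨_, (hpath.2 k hi).2, h⟩)
end
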